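/- arXiv:2106.11178 — 6 statements merged into one kernel-verified Lean document; each statement's English description precedes it below -/
import Mathlib

section
/- Let G be a simple graph on a finite vertex set V with n = |V| ≥ 1, let i ∈ V be a vertex with d := deg(i) ≥ 1, and let λ denote Lebesgue measure. Let (A_j)_{j∈V} be an allocation of [0,1] with λ(A_j) = 1/n for every j ∈ V. Let x ∈ (0,1) and ε > 0 with [x−ε, x+ε] ⊆ [0,1], and suppose the two intervals [x−ε, x] and [x, x+ε] are labeled I_2 and I_0 (in some order) so that I_2 ⊆ ⋃_{j∈N(i)} A_j and λ(I_0 ∩ ⋃_{j∈N(i)} A_j) = 0. Let v_i be the measure on [0,1] with density equal to 2 on I_2, 0 on I_0, and 1 on the rest of [0,1]. Then v_i is a probability measure on [0,1], and (1/d) · Σ_{j∈N(i)} v_i(A_j) = 1/n + ε/d > 1/n ≥ v_i(A_i); in particular the allocation is not locally proportional at agent i with respect to the valuation v_i. -/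
open MeasureTheory Finset
open scoped ENNReal

open Classical in
/-- The adversarial valuation from the proof of Lemma 2 of the paper: the measure on
`[0,1]` whose density is `2` on `I₂`, `0` on `I₀`, and `1` on the rest of `[0,1]`. -/
noncomputable def advValuation (I₂ I₀ : Set ℝ) : Measure ℝ :=
  (volume.restrict (Set.Icc (0 : ℝ) 1)).withDensity
    (fun y => if y ∈ I₂ then 2 else if y ∈ I₀ then 0 else 1)

/-- The density identity, integrated over a measurable set. -/
lemma advValuation_add (I₂ I₀ S : Set ℝ) (x : ℝ) (h₂ : MeasurableSet I₂) (h₀ : MeasurableSet I₀)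
    (hS : MeasurableSet S) (hI : I₂ ∩ I₀ ⊆ {x}) :
    advValuation I₂ I₀ S + (volume.restrict (Set.Icc (0 : ℝ) 1)) (S ∩ I₀)
      = (volume.restrict (Set.Icc (0 : ℝ) 1)) S
        + (volume.restrict (Set.Icc (0 : ℝ) 1)) (S ∩ I₂) := by
  classical
  set ν : Measure ℝ := volume.restrict (Set.Icc (0 : ℝ) 1) with hν
  have e1 : advValuation I₂ I₀ S
      = ∫⁻ y in S, (if y ∈ I₂ then 2 else if y ∈ I₀ then 0 else 1) ∂ν := by
    unfold advValuation
    rw [withDensity_apply _ hS]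
  have e2 : ∀ T : Set ℝ, MeasurableSet T → ν (S ∩ T) = ∫⁻ y in S, T.indicator 1 y ∂ν := by
    intro T hT
    rw [lintegral_indicator_one hT, Measure.restrict_apply hT, Set.inter_comm]
  have e3 : ν S = ∫⁻ _ in S, 1 ∂ν := by simp
  rw [e1, e2 _ h₂, e2 _ h₀, e3, ← lintegral_add_right _ (measurable_one.indicator h₀),
    ← lintegral_add_right _ (measurable_one.indicator h₂)]
  refine lintegral_congr_ae ?_
  have hx : ∀ᵐ y ∂(ν.restrict S), y ≠ x := by
    refine ae_restrict_of_ae (ae_restrict_of_ae ?_)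
    exact Measure.ae_ne volume x
  filter_upwards [hx] with y hy
  by_cases a : y ∈ I₂
  · have b : y ∉ I₀ := fun b => hy (hI ⟨a, b⟩)
    simp [a, b, one_add_one_eq_two]
  · by_cases b : y ∈ I₀ <;> simp [a, b]

/-- The key step in the proof of Lemma 2 of the paper: given an allocation in which every
agent receives a piece of Lebesgue measure exactly `1/n`, a point `x ∈ (0,1)`, and
adjacent intervals `I₂ ⊆ ⋃_{j ∈ N(i)} A j` and `I₀` (meeting `⋃_{j ∈ N(i)} A j` in
measure zero) of length `ε` on either side of `x`, the adversarial valuation `v_i` with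
density `2` on `I₂`, `0` on `I₀` and `1` elsewhere on `[0,1]` is a probability measure,
the average value of `i`'s neighbors' pieces under `v_i` equals `1/n + ε/deg(i) > 1/n ≥
v_i(A_i)`; in particular the allocation is not locally proportional at `i` for `v_i`. -/
theorem adversarial_valuation_breaks_local_proportionality
    {V : Type*} [Fintype V] [DecidableEq V]
    (G : SimpleGraph V) [DecidableRel G.Adj]
    (hn : 1 ≤ Fintype.card V)
    (i : V) (hd : 1 ≤ G.degree i)
    (A : V → Set ℝ)
    (hmeas : ∀ j, MeasurableSet (A j))
    (hsub : ∀ j, A j ⊆ Set.Icc (0 : ℝ) 1)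
    (hcover : (⋃ j, A j) = Set.Icc (0 : ℝ) 1)
    (hnull : ∀ j k, j ≠ k → volume (A j ∩ A k) = 0)
    (hsize : ∀ j, volume (A j) = 1 / (Fintype.card V : ℝ≥0∞))
    (x ε : ℝ) (hx : x ∈ Set.Ioo (0 : ℝ) 1) (hε : 0 < ε)
    (hIcc : Set.Icc (x - ε) (x + ε) ⊆ Set.Icc (0 : ℝ) 1)
    (I₂ I₀ : Set ℝ)
    (hlabel : (I₂ = Set.Icc (x - ε) x ∧ I₀ = Set.Icc x (x + ε)) ∨
              (I₂ = Set.Icc x (x + ε) ∧ I₀ = Set.Icc (x - ε) x))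
    (hI₂ : I₂ ⊆ ⋃ j ∈ G.neighborFinset i, A j)
    (hI₀ : volume (I₀ ∩ ⋃ j ∈ G.neighborFinset i, A j) = 0) :
    IsProbabilityMeasure (advValuation I₂ I₀) ∧
    (1 / (G.degree i : ℝ≥0∞)) * ∑ j ∈ G.neighborFinset i, advValuation I₂ I₀ (A j)
        = 1 / (Fintype.card V : ℝ≥0∞) + ENNReal.ofReal ε / (G.degree i : ℝ≥0∞) ∧
    1 / (Fintype.card V : ℝ≥0∞)
        < (1 / (G.degree i : ℝ≥0∞)) * ∑ j ∈ G.neighborFinset i, advValuation I₂ I₀ (A j) ∧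
    advValuation I₂ I₀ (A i) ≤ 1 / (Fintype.card V : ℝ≥0∞) ∧
    advValuation I₂ I₀ (A i)
        < (1 / (G.degree i : ℝ≥0∞)) * ∑ j ∈ G.neighborFinset i, advValuation I₂ I₀ (A j) := by
  obtain ⟨m₂, m₀, v₂, v₀, s₂, s₀, hI⟩ : MeasurableSet I₂ ∧ MeasurableSet I₀ ∧
      volume I₂ = ENNReal.ofReal ε ∧ volume I₀ = ENNReal.ofReal ε ∧
      I₂ ⊆ Set.Icc 0 1 ∧ I₀ ⊆ Set.Icc 0 1 ∧ I₂ ∩ I₀ ⊆ {x} := by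
    have s1 : Set.Icc (x - ε) x ⊆ Set.Icc (0 : ℝ) 1 :=
      (Set.Icc_subset_Icc le_rfl (by linarith)).trans hIcc
    have s2 : Set.Icc x (x + ε) ⊆ Set.Icc (0 : ℝ) 1 :=
      (Set.Icc_subset_Icc (by linarith) le_rfl).trans hIcc
    rcases hlabel with ⟨rfl, rfl⟩ | ⟨rfl, rfl⟩
    · refine ⟨measurableSet_Icc, measurableSet_Icc, by simp, by simp, s1, s2, ?_⟩
      rintro y ⟨h1, h2⟩
      exact le_antisymm h1.2 h2.1
    · refine ⟨measurableSet_Icc, measurableSet_Icc, by simp, by simp, s2, s1, ?_⟩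
      rintro y ⟨h1, h2⟩
      exact le_antisymm h2.2 h1.1
  have hr : ∀ T : Set ℝ, T ⊆ Set.Icc 0 1 → (volume.restrict (Set.Icc (0 : ℝ) 1)) T = volume T :=
    fun T hT => Measure.restrict_eq_self _ hT
  have hA : ∀ j, advValuation I₂ I₀ (A j) + volume (A j ∩ I₀)
      = 1 / (Fintype.card V : ℝ≥0∞) + volume (A j ∩ I₂) := by
    intro j
    have := advValuation_add I₂ I₀ (A j) x m₂ m₀ (hmeas j) hI
    rwa [hr _ (hsub j), hr _ (Set.inter_subset_left.trans (hsub j)),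
      hr _ (Set.inter_subset_left.trans (hsub j)), hsize] at this
  have hN : ∀ j ∈ G.neighborFinset i, advValuation I₂ I₀ (A j)
      = 1 / (Fintype.card V : ℝ≥0∞) + volume (A j ∩ I₂) := by
    intro j hj
    have h0 : volume (A j ∩ I₀) = 0 := by
      refine measure_mono_null ?_ hI₀
      rintro y ⟨h1, h2⟩
      exact ⟨h2, Set.mem_biUnion hj h1⟩
    rw [← hA j, h0, add_zero]
  have hU : ∑ j ∈ G.neighborFinset i, volume (A j ∩ I₂) = ENNReal.ofReal ε := by
    rw [← measure_biUnion_finset₀, ← v₂]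
    · congr 1
      rw [← Set.iUnion₂_inter]
      exact Set.inter_eq_right.mpr hI₂
    · intro j _ k _ hjk
      refine measure_mono_null ?_ (hnull j k hjk)
      rintro y ⟨h1, h2⟩
      exact ⟨h1.1, h2.1⟩
    · exact fun j _ => ((hmeas j).inter m₂).nullMeasurableSet
  have hd0 : (G.degree i : ℝ≥0∞) ≠ 0 := by
    exact_mod_cast (by omega : G.degree i ≠ 0)
  have hdt : (G.degree i : ℝ≥0∞) ≠ ⊤ := ENNReal.natCast_ne_top _
  have hn0 : (Fintype.card V : ℝ≥0∞) ≠ 0 := by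
    exact_mod_cast (by omega : Fintype.card V ≠ 0)
  have hmean : (1 / (G.degree i : ℝ≥0∞)) * ∑ j ∈ G.neighborFinset i, advValuation I₂ I₀ (A j)
        = 1 / (Fintype.card V : ℝ≥0∞) + ENNReal.ofReal ε / (G.degree i : ℝ≥0∞) := by
    rw [Finset.sum_congr rfl hN, Finset.sum_add_distrib, hU, Finset.sum_const,
      SimpleGraph.card_neighborFinset_eq_degree, nsmul_eq_mul, mul_add, ← mul_assoc, one_div,
      ENNReal.inv_mul_cancel hd0 hdt, one_mul, mul_comm _ (ENNReal.ofReal ε), ← div_eq_mul_inv (ENNReal.ofReal ε)]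
  have hlt : 1 / (Fintype.card V : ℝ≥0∞)
        < (1 / (G.degree i : ℝ≥0∞)) * ∑ j ∈ G.neighborFinset i, advValuation I₂ I₀ (A j) := by
    rw [hmean]
    refine ENNReal.lt_add_right (by simp [hn0]) ?_
    exact (ENNReal.div_pos (by simpa using hε) hdt).ne'
  have hle : advValuation I₂ I₀ (A i) ≤ 1 / (Fintype.card V : ℝ≥0∞) := by
    have h0 : volume (A i ∩ I₂) = 0 := by
      refine measure_mono_null (t := ⋃ j ∈ G.neighborFinset i, A i ∩ A j) ?_ ?_
      · rw [← Set.inter_iUnion₂]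
        exact Set.inter_subset_inter_right _ hI₂
      · refine (measure_biUnion_null_iff (G.neighborFinset i).countable_toSet).mpr ?_
        intro j hj
        refine hnull i j ?_
        rintro rfl
        simp at hj
    have := hA i
    rw [h0, add_zero] at this
    rw [← this]
    exact le_self_add
  refine ⟨⟨?_⟩, hmean, hlt, hle, hle.trans_lt hlt⟩
  have := advValuation_add I₂ I₀ Set.univ x m₂ m₀ MeasurableSet.univ hI
  rw [Set.univ_inter, Set.univ_inter, hr _ s₂, hr _ s₀, v₂, v₀] at this
  have h1 := (ENNReal.add_left_inj ENNReal.ofReal_ne_top).mp this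
  rw [h1]
  simp
end

section
/- Let m be a positive integer divisible by 32, let R be a finite set with |R| = m/2, and for each r ∈ R let A_r ⊆ [0,1] be a nonempty finite union of closed intervals of positive length, such that A_r ∩ A_{r'} has Lebesgue measure zero whenever r ≠ r'. Let M be a finite set and for each i ∈ M let S_i ⊆ R, and let b_i denote the (finite) number of points in the topological frontier of ⋃_{r∈S_i} A_r. If b_i ≤ m/16 for every i ∈ M, then there exists a partition of R into m/4 two-element sets R_1, …, R_{m/4} such that for every i ∈ M, the number of indices j with |S_i ∩ R_j| = 1 is at most m/16 (i.e., at most one quarter of the m/4 blocks). -/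
open Finset

lemma seg_finite_frontier_biUnion {ι : Type*} (s : Finset ι) (F : ι → Set ℝ)
    (h : ∀ p ∈ s, (frontier (F p)).Finite) : (frontier (⋃ p ∈ s, F p)).Finite := by
  classical
  induction s using Finset.induction_on with
  | empty => simp
  | insert a s ha ih =>
    rw [Finset.set_biUnion_insert]
    refine Set.Finite.subset ?_ (frontier_union_subset _ _)
    refine Set.Finite.union ?_ ?_
    · exact (h a (by simp)).subset Set.inter_subset_left
    · exact (ih (fun p hp => h p (by simp [hp]))).subset Set.inter_subset_right

lemma seg_frontier_meets (U : Set ℝ) {a b : ℝ} (hab : a ≤ b) (h : ¬ (a ∈ U ↔ b ∈ U)) :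
    ∃ x ∈ Set.Icc a b, x ∈ frontier U := by
  by_contra! hc
  have hpre : IsPreconnected (Set.Icc a b) := isPreconnected_Icc
  have hd : Disjoint (Set.Icc a b) (frontier U) := Set.disjoint_left.2 hc
  have ha : a ∈ Set.Icc a b := ⟨le_rfl, hab⟩
  have hb : b ∈ Set.Icc a b := ⟨hab, le_rfl⟩
  have key : ∀ x ∈ Set.Icc a b, ∀ y ∈ Set.Icc a b, x ∈ U → y ∈ U := by
    intro x hx y hy hxU
    by_contra hyU
    obtain ⟨z, hz, hz'⟩ := hpre (interior U) (closure U)ᶜ isOpen_interior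
      isClosed_closure.isOpen_compl
      (fun z hz => by
        by_cases hzc : z ∈ closure U
        · left
          by_contra hi
          exact hc z hz ⟨hzc, hi⟩
        · exact Or.inr hzc)
      ⟨x, hx, by
        by_contra hi
        exact hc x hx ⟨subset_closure hxU, hi⟩⟩
      ⟨y, hy, fun hyc => hc y hy ⟨hyc, fun hi => hyU (interior_subset hi)⟩⟩
    exact hz'.2 (subset_closure (interior_subset hz'.1))
  exact h ⟨key a ha b hb, key b hb a ha⟩


/-- Lemma 3 of the paper: let `m` be a positive multiple of 32, `R` a set of `m/2`
agents, and `(A r)` pieces of cake in `[0,1]`, each a nonempty finite union of closed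
intervals of positive length, overlapping pairwise in Lebesgue measure zero. If for
every `i ∈ M` the frontier of `⋃_{r ∈ S i} A r` has at most `m/16` points, then there
is a partition of `R` into `m/4` two-element blocks `B 1, …, B (m/4)` such that for
every `i ∈ M`, at most `m/16` of the blocks (one quarter of them) meet `S i` in exactly
one element; i.e., `M` has a segmentation. -/
theorem few_boundary_points_implies_segmentation
    {R : Type*} [Fintype R] [DecidableEq R]
    (m : ℕ) (hm : 0 < m) (h32 : 32 ∣ m)
    (hR : Fintype.card R = m / 2)
    (A : R → Set ℝ)
    (hA : ∀ r, ∃ s : Finset (ℝ × ℝ), s.Nonempty ∧ (∀ p ∈ s, p.1 < p.2) ∧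
      A r = ⋃ p ∈ s, Set.Icc p.1 p.2)
    (hsub : ∀ r, A r ⊆ Set.Icc (0 : ℝ) 1)
    (hnull : ∀ r r', r ≠ r' → MeasureTheory.volume (A r ∩ A r') = 0)
    {M : Type*} [Finite M] (S : M → Finset R)
    (hb : ∀ i : M, (frontier (⋃ r ∈ S i, A r)).ncard ≤ m / 16) :
    ∃ B : Fin (m / 4) → Finset R,
      (∀ j, (B j).card = 2) ∧
      (∀ j k, j ≠ k → Disjoint (B j) (B k)) ∧
      (∀ r : R, ∃ j, r ∈ B j) ∧
      ∀ i : M,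
        (Finset.univ.filter (fun j => (S i ∩ B j).card = 1)).card ≤ m / 16 := by
  classical
  have hfin : ∀ i, (frontier (⋃ r ∈ S i, A r)).Finite := by
    intro i
    refine seg_finite_frontier_biUnion _ _ fun r _ => ?_
    obtain ⟨s, -, hs, he⟩ := hA r
    rw [he]
    refine seg_finite_frontier_biUnion _ _ fun p hp => ?_
    rw [frontier_Icc (hs p hp).le]
    exact Set.toFinite _
  have hf : ∀ r, ∃ x, x ∈ A r ∧ ∀ r', r ≠ r' → x ∉ A r' := by
    intro r
    obtain ⟨s, ⟨p, hp⟩, hs, he⟩ := hA r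
    have hpA : Set.Icc p.1 p.2 ⊆ A r := by
      rw [he]
      exact Set.subset_biUnion_of_mem (u := fun p : ℝ × ℝ => Set.Icc p.1 p.2) hp
    obtain ⟨x, hx⟩ := Set.nonempty_Ioo.2 (hs p hp)
    refine ⟨x, hpA (Set.Ioo_subset_Icc_self hx), fun r' hr hx' => ?_⟩
    obtain ⟨t, -, ht, he'⟩ := hA r'
    rw [he'] at hx'
    obtain ⟨q, hq, hxq⟩ := Set.mem_iUnion₂.1 hx'
    have hqA : Set.Icc q.1 q.2 ⊆ A r' := by
      rw [he']
      exact Set.subset_biUnion_of_mem (u := fun p : ℝ × ℝ => Set.Icc p.1 p.2) hq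
    have hcl : x ∈ closure (Set.Ioo q.1 q.2) := by
      rw [closure_Ioo (ht q hq).ne]
      exact hxq
    have hne := mem_closure_iff.1 hcl _ isOpen_Ioo hx
    have hpos := (isOpen_Ioo.inter isOpen_Ioo).measure_pos MeasureTheory.volume hne
    refine hpos.ne' (MeasureTheory.measure_mono_null ?_ (hnull r r' hr))
    exact Set.inter_subset_inter (Set.Ioo_subset_Icc_self.trans hpA)
      (Set.Ioo_subset_Icc_self.trans hqA)
  choose f hfA hfN using hf
  have hinj : Function.Injective f := by
    intro r r' h
    by_contra hne
    exact hfN r r' hne (h ▸ hfA r')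
  have hU : ∀ i r, f r ∈ (⋃ r ∈ S i, A r) ↔ r ∈ S i := by
    intro i r
    constructor
    · intro h
      obtain ⟨r', hr', hx⟩ := Set.mem_iUnion₂.1 h
      by_contra hr
      exact hfN r r' (fun h => hr (h ▸ hr')) hx
    · intro h
      exact Set.mem_iUnion₂.2 ⟨r, h, hfA r⟩
  have hcard : (Finset.univ.image f).card = m / 2 := by
    rw [Finset.card_image_of_injective _ hinj, Finset.card_univ, hR]
  have hg : ∀ k : Fin (m / 2), ∃ r, f r = (Finset.univ.image f).orderEmbOfFin hcard k := by
    intro k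
    have := Finset.orderEmbOfFin_mem (Finset.univ.image f) hcard k
    obtain ⟨r, -, hr⟩ := Finset.mem_image.1 this
    exact ⟨r, hr⟩
  choose g hg using hg
  have hmono : StrictMono (fun k => f (g k)) := by
    intro a b hab
    simp only [hg]
    exact (Finset.orderEmbOfFin _ hcard).strictMono hab
  have hginj : Function.Injective g := fun a b h => hmono.injective (by simp [h])
  have hgbij : Function.Bijective g :=
    (Fintype.bijective_iff_injective_and_card g).2 ⟨hginj, by simp [hR]⟩
  have h24 : m / 2 = 2 * (m / 4) := by omega
  let lo : Fin (m / 4) → Fin (m / 2) := fun j => ⟨2 * j, by omega⟩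
  let hi : Fin (m / 4) → Fin (m / 2) := fun j => ⟨2 * j + 1, by omega⟩
  have hlohi : ∀ j, lo j < hi j := fun j => by simp [lo, hi, Fin.lt_def]
  have hnext : ∀ j k, j < k → hi j < lo k := fun j k h => by
    simp only [lo, hi, Fin.lt_def] at h ⊢
    omega
  have hne : ∀ j k, lo j ≠ hi k := fun j k h => by
    simp only [lo, hi, Fin.mk.injEq] at h
    omega
  have hloinj : ∀ j k, lo j = lo k → j = k := fun j k h => by
    simp only [lo, Fin.mk.injEq] at h
    exact Fin.ext (by omega)
  have hhiinj : ∀ j k, hi j = hi k → j = k := fun j k h => by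
    simp only [hi, Fin.mk.injEq] at h
    exact Fin.ext (by omega)
  refine ⟨fun j => {g (lo j), g (hi j)}, ?_, ?_, ?_, ?_⟩
  · intro j
    exact Finset.card_pair (fun h => hne j j (hginj h))
  · intro j k hjk
    rw [Finset.disjoint_left]
    intro r h1 h2
    simp only [Finset.mem_insert, Finset.mem_singleton] at h1 h2
    rcases h1 with rfl | rfl <;> rcases h2 with h2 | h2
    · exact hjk (hloinj _ _ (hginj h2))
    · exact hne _ _ (hginj h2)
    · exact hne _ _ (hginj h2).symm
    · exact hjk (hhiinj _ _ (hginj h2))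
  · intro r
    obtain ⟨k, rfl⟩ := hgbij.2 r
    have hk := k.2
    refine ⟨⟨k / 2, by omega⟩, ?_⟩
    simp only [Finset.mem_insert, Finset.mem_singleton]
    rcases Nat.mod_two_eq_zero_or_one k with h | h
    · left
      congr 1
      apply Fin.ext
      simp only [lo]
      omega
    · right
      congr 1
      apply Fin.ext
      simp only [hi]
      omega
  · intro i
    refine le_trans ?_ (hb i)
    have hx : ∀ j, ∃ x, x ∈ Set.Icc (f (g (lo j))) (f (g (hi j))) ∧
        ((S i ∩ {g (lo j), g (hi j)}).card = 1 → x ∈ frontier (⋃ r ∈ S i, A r)) := by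
      intro j
      have hle := (hmono (hlohi j)).le
      by_cases hj : (S i ∩ {g (lo j), g (hi j)}).card = 1
      · obtain ⟨x, hx, hx'⟩ := seg_frontier_meets (⋃ r ∈ S i, A r) hle (by
          rw [hU, hU]
          intro hiff
          have hgne : g (lo j) ≠ g (hi j) := fun h => hne j j (hginj h)
          by_cases h1 : g (hi j) ∈ S i
          · have h2 := hiff.2 h1
            rw [Finset.inter_eq_right.2 (by
              intro r hr
              simp only [Finset.mem_insert, Finset.mem_singleton] at hr
              rcases hr with rfl | rfl <;> assumption), Finset.card_pair hgne] at hj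
            omega
          · have h2 : g (lo j) ∉ S i := fun h => h1 (hiff.1 h)
            have h0 : S i ∩ {g (lo j), g (hi j)} = ∅ := by
              ext r
              simp only [Finset.mem_inter, Finset.mem_insert, Finset.mem_singleton,
                Finset.notMem_empty, iff_false]
              rintro ⟨hr, rfl | rfl⟩ <;> contradiction
            rw [h0] at hj
            simp at hj)
        exact ⟨x, hx, fun _ => hx'⟩
      · exact ⟨_, ⟨le_rfl, hle⟩, fun h => absurd h hj⟩
    choose x hxI hxF using hx
    have hxmono : StrictMono x := fun j k hjk =>
      lt_of_le_of_lt (hxI j).2 (lt_of_lt_of_le (hmono (hnext j k hjk)) (hxI k).1)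
    rw [← Set.ncard_coe_finset]
    refine Set.ncard_le_ncard_of_injOn x ?_ hxmono.injective.injOn (hfin i)
    intro j hj
    exact hxF j (by simpa using hj)
end

section
/- Let m be a positive integer divisible by 32, let R be a finite set with |R| = m/2, and let R_1, …, R_{m/4} be a fixed partition of R into two-element sets. If S is chosen uniformly at random among all subsets of R of size m/4, then the probability that at most (5/8)·(m/4) of the blocks R_j satisfy R_j ∩ S ≠ ∅ is at most exp(−m/128). Equivalently, the number of (m/4)-element subsets S of R for which #{j : R_j ∩ S ≠ ∅} ≤ (5/8)·(m/4) is at most exp(−m/128) · C(m/2, m/4). -/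
open Finset

theorem two_mul_choose_le (n a : ℕ) (h : a + 1 ≤ 2 * n) :
    2 * a.choose n ≤ (a + 1).choose n := by
  rcases lt_or_ge a n with h1 | h1
  · simp [Nat.choose_eq_zero_of_lt h1]
  · have h2 := Nat.choose_mul_succ_eq a n
    obtain ⟨c, rfl⟩ := Nat.exists_eq_add_of_le h1
    have h3 : n + c + 1 - n = c + 1 := by omega
    rw [h3] at h2
    have h4 : 2 * (c + 1) ≤ n + c + 1 := by omega
    have h5 : (2 * (n + c).choose n) * (c + 1) ≤ (n + c + 1).choose n * (c + 1) := by
      rw [← h2]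
      calc (2 * (n + c).choose n) * (c + 1) = (n + c).choose n * (2 * (c + 1)) := by ring
        _ ≤ _ := Nat.mul_le_mul_left _ h4
    exact Nat.le_of_mul_le_mul_right h5 (by omega)

theorem four_pow_mul_choose_le (n k : ℕ) (hk : k ≤ n) :
    4 ^ k * (2 * n - 2 * k).choose n ≤ (2 * n).choose n := by
  induction k with
  | zero => simp
  | succ k ih =>
    have ih := ih (by omega)
    have h1 := two_mul_choose_le n (2 * n - 2 * (k + 1)) (by omega)
    have h2 := two_mul_choose_le n (2 * n - 2 * (k + 1) + 1) (by omega)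
    have h3 : 2 * n - 2 * (k + 1) + 1 + 1 = 2 * n - 2 * k := by omega
    rw [h3] at h2
    calc 4 ^ (k + 1) * (2 * n - 2 * (k + 1)).choose n
        = 4 ^ k * (2 * (2 * (2 * n - 2 * (k + 1)).choose n)) := by ring
      _ ≤ 4 ^ k * (2 * n - 2 * k).choose n := by gcongr; omega
      _ ≤ _ := ih

theorem sum_two_pow_missed_le {R : Type*} [Fintype R] [DecidableEq R] (n : ℕ)
    (hR : Fintype.card R = 2 * n) (B : Fin n → Finset R)
    (hB2 : ∀ j, (B j).card = 2)
    (hBdisj : ∀ j k, j ≠ k → Disjoint (B j) (B k)) :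
    ∑ S ∈ Finset.powersetCard n (Finset.univ : Finset R),
      (2 : ℝ) ^ (Finset.univ.filter (fun j => ¬ (B j ∩ S).Nonempty)).card
      ≤ (5 / 4 : ℝ) ^ n * ((2 * n).choose n : ℝ) := by
  have h1 : ∀ S : Finset R,
      (2 : ℝ) ^ (Finset.univ.filter (fun j => ¬ (B j ∩ S).Nonempty)).card
      = ∑ T : Finset (Fin n), if S ⊆ (T.biUnion B)ᶜ then (1 : ℝ) else 0 := by
    intro S
    rw [Finset.sum_boole]
    have : (Finset.univ.filter (fun T : Finset (Fin n) => S ⊆ (T.biUnion B)ᶜ))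
        = (Finset.univ.filter (fun j => ¬ (B j ∩ S).Nonempty)).powerset := by
      ext T
      simp only [mem_filter, mem_univ, true_and, mem_powerset, Finset.not_nonempty_iff_eq_empty,
        ← Finset.disjoint_iff_inter_eq_empty, Finset.disjoint_left, Finset.subset_iff,
        mem_compl, mem_biUnion, not_exists, not_and]
      exact ⟨fun h j hj x hx hS => h hS j hj hx, fun h x hS j hj hx => h hj hx hS⟩
    rw [this, card_powerset]
    push_cast
    rfl
  simp_rw [h1]
  rw [Finset.sum_comm]
  have h2 : ∀ T : Finset (Fin n),
      (∑ S ∈ Finset.powersetCard n (Finset.univ : Finset R),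
        if S ⊆ (T.biUnion B)ᶜ then (1 : ℝ) else 0)
      ≤ (1 / 4 : ℝ) ^ T.card * ((2 * n).choose n : ℝ) := by
    intro T
    rw [Finset.sum_boole]
    have e : (Finset.powersetCard n (Finset.univ : Finset R)).filter
        (fun S => S ⊆ (T.biUnion B)ᶜ) = Finset.powersetCard n ((T.biUnion B)ᶜ) := by
      ext S
      simp only [mem_filter, mem_powersetCard, subset_univ, true_and]
      tauto
    have c : (T.biUnion B).card = 2 * T.card := by
      rw [Finset.card_biUnion (fun j _ k _ h => hBdisj j k h)]
      simp [hB2, mul_comm]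
    have hT : T.card ≤ n := by simpa using Finset.card_le_univ T
    rw [e, card_powersetCard, card_compl, c, hR]
    have h := four_pow_mul_choose_le n T.card hT
    have h' : (4 : ℝ) ^ T.card * ((2 * n - 2 * T.card).choose n : ℝ) ≤ ((2 * n).choose n : ℝ) := by
      exact_mod_cast h
    rw [one_div, inv_pow, inv_mul_eq_div, le_div_iff₀ (by positivity), mul_comm]
    exact h'
  refine (Finset.sum_le_sum fun T _ => h2 T).trans ?_
  rw [← Finset.sum_mul]
  have h3 := Fintype.sum_pow_mul_eq_add_pow (Fin n) (1 / 4 : ℝ) 1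
  simp only [one_pow, mul_one, Fintype.card_fin] at h3
  rw [h3]
  norm_num

/-- The Hoeffding-type concentration step in the proof of Lemma 4 of the paper: if
`m` is a positive multiple of 32, `R` has `m/2` elements, and `B 1, …, B (m/4)` is a
fixed partition of `R` into two-element blocks, then the number of `(m/4)`-element
subsets `S` of `R` for which at most `(5/8)·(m/4) = 5m/32` of the blocks meet `S` is at
most `exp(−m/128) · C(m/2, m/4)`; equivalently, for a uniformly random `(m/4)`-subset
`S`, the probability that at most `(5/8)·(m/4)` blocks meet `S` is at most
`exp(−m/128)`. -/
theorem hoeffding_bound_blocks_hit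
    {R : Type*} [Fintype R] [DecidableEq R]
    (m : ℕ) (hm : 0 < m) (h32 : 32 ∣ m)
    (hR : Fintype.card R = m / 2)
    (B : Fin (m / 4) → Finset R)
    (hB2 : ∀ j, (B j).card = 2)
    (hBdisj : ∀ j k, j ≠ k → Disjoint (B j) (B k))
    (hBcover : ∀ r : R, ∃ j, r ∈ B j) :
    (((Finset.powersetCard (m / 4) (Finset.univ : Finset R)).filter
        (fun S => (Finset.univ.filter (fun j => (B j ∩ S).Nonempty)).card ≤ 5 * m / 32)).card : ℝ)
      ≤ Real.exp (-(m : ℝ) / 128) * (Nat.choose (m / 2) (m / 4) : ℝ) := by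
  obtain ⟨p, rfl⟩ := h32
  have e2 : 32 * p / 2 = 2 * (32 * p / 4) := by omega
  have e5 : 5 * (32 * p) / 32 = 5 * p := by omega
  rw [e2] at hR ⊢
  rw [e5]
  have key := sum_two_pow_missed_le _ hR B hB2 hBdisj
  have e4 : 32 * p / 4 = 8 * p := by omega
  generalize 32 * p / 4 = n at *
  subst e4
  set C : ℝ := ((2 * (8 * p)).choose (8 * p) : ℝ) with hC
  set F := (Finset.powersetCard (8 * p) (Finset.univ : Finset R)).filter
    (fun S => (Finset.univ.filter (fun j => (B j ∩ S).Nonempty)).card ≤ 5 * p) with hF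
  have low : (F.card : ℝ) * 2 ^ (3 * p) ≤ (5 / 4 : ℝ) ^ (8 * p) * C := by
    refine le_trans ?_ key
    refine le_trans ?_ (Finset.sum_le_sum_of_subset_of_nonneg (Finset.filter_subset _ _ : F ⊆ _)
      (fun _ _ _ => by positivity))
    rw [← nsmul_eq_mul]
    refine Finset.card_nsmul_le_sum _ _ _ fun S hS => ?_
    refine pow_le_pow_right₀ (by norm_num) ?_
    have h1 := (Finset.mem_filter.1 hS).2
    have h2 := Finset.card_filter_add_card_filter_not (s := (Finset.univ : Finset (Fin (8 * p))))
      (fun j => (B j ∩ S).Nonempty)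
    rw [Finset.card_univ, Fintype.card_fin] at h2
    omega
  have hexp : Real.exp (-((32 * p : ℕ) : ℝ) / 128) = Real.exp (-(1 / 4)) ^ p := by
    rw [← Real.exp_nat_mul]
    congr 1
    push_cast
    ring
  have hq : (5 / 4 : ℝ) ^ 8 ≤ Real.exp (-(1 / 4)) * 8 := by
    have := Real.add_one_le_exp (-(1 / 4 : ℝ))
    norm_num at this ⊢
    linarith
  have hqp : (5 / 4 : ℝ) ^ (8 * p) ≤ Real.exp (-(1 / 4)) ^ p * 2 ^ (3 * p) := by
    rw [pow_mul, pow_mul, ← mul_pow]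
    refine pow_le_pow_left₀ (by positivity) ?_ p
    norm_num at hq ⊢
    exact hq
  rw [hexp]
  have hC0 : 0 ≤ C := by positivity
  have h2 : (0 : ℝ) < 2 ^ (3 * p) := by positivity
  refine le_of_mul_le_mul_right ?_ h2
  calc (F.card : ℝ) * 2 ^ (3 * p) ≤ (5 / 4 : ℝ) ^ (8 * p) * C := low
    _ ≤ (Real.exp (-(1 / 4)) ^ p * 2 ^ (3 * p)) * C := by gcongr
    _ = _ := by ring
end

section
/- Let m be a positive integer divisible by 32, let R be a finite set with |R| = m/2, and let R_1, …, R_{m/4} be a fixed partition of R into two-element sets. If S is chosen uniformly at random among all subsets of R of size m/4, then the probability that at most m/16 of the blocks R_j satisfy |S ∩ R_j| = 1 is at most 2·exp(−m/128). Equivalently, the number of (m/4)-element subsets S of R for which #{j : |S ∩ R_j| = 1} ≤ m/16 is at most 2·exp(−m/128) · C(m/2, m/4). -/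
open Finset

lemma aux_central (n : ℕ) (hn : 1 ≤ n) : 16 ^ n ≤ 4 * n * (Nat.centralBinom n) ^ 2 := by
  induction n, hn using Nat.le_induction with
  | base => simp [Nat.centralBinom, Nat.choose]
  | succ n hn ih =>
    have h := Nat.succ_mul_centralBinom_succ n
    have h2 : (n + 1) * 16 ^ (n + 1) ≤ (n + 1) * (4 * (n + 1) * (Nat.centralBinom (n + 1)) ^ 2) := by
      calc (n + 1) * 16 ^ (n + 1) = 16 * (n + 1) * 16 ^ n := by ring
        _ ≤ 16 * (n + 1) * (4 * n * (Nat.centralBinom n) ^ 2) := by gcongr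
        _ = (16 * (4 * n ^ 2 + 4 * n)) * (Nat.centralBinom n) ^ 2 := by ring
        _ ≤ (16 * (2 * n + 1) ^ 2) * (Nat.centralBinom n) ^ 2 := by
          gcongr
          nlinarith
        _ = 4 * (2 * (2 * n + 1) * Nat.centralBinom n) ^ 2 := by ring
        _ = 4 * ((n + 1) * Nat.centralBinom (n + 1)) ^ 2 := by rw [h]
        _ = _ := by ring
    exact Nat.le_of_mul_le_mul_left h2 (Nat.succ_pos n)

lemma aux_gen {R : Type*} [Fintype R] [DecidableEq R] (n : ℕ)
    (B : Fin n → Finset R) (hB2 : ∀ j, (B j).card = 2)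
    (hBcover : ∀ r : R, ∃ j, r ∈ B j) :
    ∑ S : Finset R, (1 / 3 : ℝ) ^ (univ.filter (fun j => (S ∩ B j).card = 1)).card
      ≤ (8 / 3 : ℝ) ^ n := by
  set w : ℕ → ℝ := fun c => if c = 1 then 1 / 3 else 1 with hw
  have hw0 : ∀ c, 0 ≤ w c := by
    intro c
    simp only [hw]
    split_ifs <;> norm_num
  have h1 : ∀ S : Finset R, (1 / 3 : ℝ) ^ (univ.filter (fun j => (S ∩ B j).card = 1)).card
      = ∏ j, w ((S ∩ B j).card) := by
    intro S
    simp only [hw]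
    rw [Finset.prod_ite]
    simp
  have hinj : Function.Injective (fun (S : Finset R) (j : Fin n) => S ∩ B j) := by
    intro S T h
    ext r
    obtain ⟨j, hj⟩ := hBcover r
    have h' := congrFun h j
    have h'' := Finset.ext_iff.mp h' r
    simpa [hj] using h''
  calc ∑ S : Finset R, (1 / 3 : ℝ) ^ (univ.filter (fun j => (S ∩ B j).card = 1)).card
      = ∑ S : Finset R, ∏ j, w ((S ∩ B j).card) := Finset.sum_congr rfl (fun S _ => h1 S)
    _ = ∑ p ∈ (univ : Finset (Finset R)).image (fun S j => S ∩ B j), ∏ j, w ((p j).card) := by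
      rw [Finset.sum_image (fun a _ b _ h => hinj h)]
    _ ≤ ∑ p ∈ Fintype.piFinset (fun j => (B j).powerset), ∏ j, w ((p j).card) := by
      apply Finset.sum_le_sum_of_subset_of_nonneg
      · intro p hp
        obtain ⟨S, -, rfl⟩ := Finset.mem_image.mp hp
        simp [Fintype.mem_piFinset]
      · intro p _ _
        exact Finset.prod_nonneg (fun j _ => hw0 _)
    _ = ∏ j, ∑ T ∈ (B j).powerset, w T.card := by
      rw [Finset.prod_univ_sum]
    _ = (8 / 3 : ℝ) ^ n := by
      have : ∀ j, ∑ T ∈ (B j).powerset, w T.card = 8 / 3 := by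
        intro j
        rw [Finset.sum_powerset_apply_card, hB2]
        simp [Finset.sum_range_succ, hw]
        norm_num
      simp [this, div_pow]

/-- The per-agent bound in the proof of Lemma 4 of the paper: if `m` is a positive
multiple of 32, `R` has `m/2` elements, and `B 1, …, B (m/4)` is a fixed partition of
`R` into two-element blocks, then the number of `(m/4)`-element subsets `S` of `R` for
which at most `m/16` of the blocks meet `S` in exactly one element is at most
`2·exp(−m/128) · C(m/2, m/4)`; equivalently, for a uniformly random `(m/4)`-subset `S`,
the probability that at most `m/16` blocks are "mixed" is at most `2·exp(−m/128)`. -/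
theorem per_agent_segmentation_probability_bound
    {R : Type*} [Fintype R] [DecidableEq R]
    (m : ℕ) (hm : 0 < m) (h32 : 32 ∣ m)
    (hR : Fintype.card R = m / 2)
    (B : Fin (m / 4) → Finset R)
    (hB2 : ∀ j, (B j).card = 2)
    (hBdisj : ∀ j k, j ≠ k → Disjoint (B j) (B k))
    (hBcover : ∀ r : R, ∃ j, r ∈ B j) :
    (((Finset.powersetCard (m / 4) (Finset.univ : Finset R)).filter
        (fun S => (Finset.univ.filter (fun j => (S ∩ B j).card = 1)).card ≤ m / 16)).card : ℝ)
      ≤ 2 * Real.exp (-(m : ℝ) / 128) * (Nat.choose (m / 2) (m / 4) : ℝ) := by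
  obtain ⟨k, rfl⟩ := h32
  have e4 : 32 * k / 4 = 8 * k := by omega
  have e2 : 32 * k / 2 = 2 * (8 * k) := by omega
  have e16 : 32 * k / 16 = 2 * k := by omega
  have hk : 1 ≤ k := by omega
  have hgen := aux_gen _ B hB2 hBcover
  have hexp : (3 / 4 : ℝ) ^ k ≤ Real.exp (-((32 * k : ℕ) : ℝ) / 128) := by
    have : -((32 * k : ℕ) : ℝ) / 128 = k * (-(1 / 4) : ℝ) := by
      push_cast
      ring
    rw [this, Real.exp_nat_mul]
    gcongr
    have := Real.add_one_le_exp (-(1 / 4) : ℝ)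
    linarith
  set F := ((Finset.powersetCard (32 * k / 4) (Finset.univ : Finset R)).filter
        (fun S => (Finset.univ.filter (fun j => (S ∩ B j).card = 1)).card ≤ 32 * k / 16)) with hF
  set E := Real.exp (-((32 * k : ℕ) : ℝ) / 128) with hE
  have hE0 : 0 < E := Real.exp_pos _
  have hcb : Nat.choose (32 * k / 2) (32 * k / 4) = Nat.centralBinom (8 * k) := by
    rw [e2, e4, Nat.centralBinom]
  have htriv : F.card ≤ Nat.centralBinom (8 * k) := by
    rw [← hcb, ← hR, ← Finset.card_univ, ← Finset.card_powersetCard]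
    exact Finset.card_filter_le _ _
  rw [hcb]
  set C := Nat.centralBinom (8 * k) with hC
  rcases Nat.lt_or_ge k 2 with hk2 | hk2
  · have : k = 1 := by omega
    have h34 : (3 / 4 : ℝ) ≤ E := by simpa [this] using hexp
    have : (F.card : ℝ) ≤ C := by exact_mod_cast htriv
    have hC0 : (0 : ℝ) ≤ C := Nat.cast_nonneg _
    nlinarith
  have hA : (F.card : ℝ) * (1 / 3) ^ (2 * k) ≤ (8 / 3 : ℝ) ^ (8 * k) := by
    refine le_trans ?_ (hgen.trans_eq (congrArg (fun i => (8 / 3 : ℝ) ^ i) e4))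
    rw [← nsmul_eq_mul]
    refine le_trans (Finset.card_nsmul_le_sum F
      (fun S => (1 / 3 : ℝ) ^ (univ.filter (fun j => (S ∩ B j).card = 1)).card) _ ?_) ?_
    · intro S hS
      have := (Finset.mem_filter.mp hS).2
      rw [e16] at this
      exact pow_le_pow_of_le_one (by norm_num) (by norm_num) this
    · exact Finset.sum_le_sum_of_subset_of_nonneg (Finset.subset_univ _)
        (fun _ _ _ => by positivity)
  have hA2 : (F.card : ℝ) * 2 ^ k ≤ 4 ^ (8 * k) * E := by
    have h9 : (1 / 3 : ℝ) ^ (2 * k) * 9 ^ k = 1 := by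
      rw [pow_mul, ← mul_pow]
      norm_num
    calc (F.card : ℝ) * 2 ^ k = F.card * ((1 / 3 : ℝ) ^ (2 * k) * 9 ^ k) * 2 ^ k := by
          rw [h9, mul_one]
      _ = (F.card * (1 / 3 : ℝ) ^ (2 * k)) * (9 ^ k * 2 ^ k) := by ring
      _ ≤ (8 / 3 : ℝ) ^ (8 * k) * (9 ^ k * 2 ^ k) := by gcongr
      _ = ((8 / 3 : ℝ) ^ 8 * (9 * 2)) ^ k := by rw [pow_mul, ← mul_pow, ← mul_pow]
      _ ≤ ((4 : ℝ) ^ 8 * (3 / 4)) ^ k := by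
          gcongr ?_ ^ k
          norm_num
      _ = 4 ^ (8 * k) * (3 / 4) ^ k := by rw [pow_mul, ← mul_pow]
      _ ≤ _ := by gcongr
  have h4k : 8 * k ≤ 4 ^ k := by
    clear * - hk2
    induction k, hk2 using Nat.le_induction with
    | base => norm_num
    | succ n hn ih =>
      rw [pow_succ]
      omega
  have hcen : (4 : ℝ) ^ (8 * k) ≤ 2 * 2 ^ k * C := by
    have h1 : 16 ^ (8 * k) ≤ 4 * (8 * k) * C ^ 2 := aux_central (8 * k) (by omega)
    have h2 : (4 ^ (8 * k)) ^ 2 ≤ (2 * 2 ^ k * C) ^ 2 := by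
      calc (4 ^ (8 * k)) ^ 2 = 16 ^ (8 * k) := by
            rw [← pow_mul, mul_comm, pow_mul]
            norm_num
        _ ≤ 4 * (8 * k) * C ^ 2 := h1
        _ ≤ 4 * 4 ^ k * C ^ 2 := by gcongr
        _ = (2 * 2 ^ k * C) ^ 2 := by
            rw [mul_pow, mul_pow, ← pow_mul 2 k 2, mul_comm k 2, pow_mul 2 2 k]
            norm_num
    have h3 := (Nat.pow_le_pow_iff_left (by norm_num)).mp h2
    exact_mod_cast h3
  have h2k : (0 : ℝ) < 2 ^ k := by positivity
  refine le_of_mul_le_mul_right ?_ h2k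
  calc (F.card : ℝ) * 2 ^ k ≤ 4 ^ (8 * k) * E := hA2
    _ ≤ (2 * 2 ^ k * C) * E := by gcongr
    _ = _ := by ring
end

section
/- Let m be a positive integer divisible by 32, let L and R be finite sets with |L| = |R| = m/2, and suppose (S_i)_{i∈L} are independent random variables, each distributed uniformly on the (m/4)-element subsets of R (equivalently, a function S : L → {(m/4)-subsets of R} is chosen uniformly at random). Let p_m be the probability that there exist a set M ⊆ L with |M| = m/4 and a partition of R into two-element blocks R_1, …, R_{m/4} such that for every i ∈ M at most m/16 of the blocks satisfy |S_i ∩ R_j| = 1. Then p_m ≤ C(m/2, m/4) · (m/2 − 1)!! · 2^{m/4} · exp(−m²/512), where C(a,b) is the binomial coefficient and (2k−1)!! denotes the product of the odd positive integers below 2k. -/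
open Finset

/-- `16^n ≤ 4 n C(2n,n)^2`. -/
lemma seg_central (n : ℕ) (hn : 1 ≤ n) : 16 ^ n ≤ 4 * n * n.centralBinom ^ 2 := by
  induction n, hn using Nat.le_induction with
  | base => simp [Nat.centralBinom, Nat.choose]
  | succ n hn ih =>
    have h := Nat.succ_mul_centralBinom_succ n
    have h1 : (n + 1) * 16 ^ (n + 1) ≤ (n + 1) * (4 * (n + 1) * (n + 1).centralBinom ^ 2) := by
      calc (n + 1) * 16 ^ (n + 1) ≤ (n + 1) * (16 * (4 * n * n.centralBinom ^ 2)) := by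
            rw [pow_succ]; nlinarith
        _ ≤ 4 * (2 * (2 * n + 1) * n.centralBinom) ^ 2 := by
            have : (n + 1) * (16 * (4 * n)) ≤ 4 * (2 * (2 * n + 1)) ^ 2 := by nlinarith
            calc _ = ((n + 1) * (16 * (4 * n))) * n.centralBinom ^ 2 := by ring
              _ ≤ (4 * (2 * (2 * n + 1)) ^ 2) * n.centralBinom ^ 2 := Nat.mul_le_mul_right _ this
              _ = _ := by ring
        _ = 4 * ((n + 1) * (n + 1).centralBinom) ^ 2 := by rw [h]
        _ = _ := by ring
    exact Nat.le_of_mul_le_mul_left h1 (Nat.succ_pos n)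

/-- Perfect matchings are at most `(2n-1)!!` many. -/
lemma seg_matchings {R : Type*} [DecidableEq R] (n : ℕ) : ∀ A : Finset R, A.card = 2 * n →
    ∃ F : Finset (Finset (Finset R)), F.card ≤ Nat.doubleFactorial (2 * n - 1) ∧
      ∀ P : Finset (Finset R), (∀ p ∈ P, p.card = 2) →
        (∀ p ∈ P, ∀ q ∈ P, p ≠ q → Disjoint p q) → (∀ x, x ∈ A ↔ ∃ p ∈ P, x ∈ p) → P ∈ F := by
  induction n with
  | zero =>
    intro A hA
    refine ⟨{∅}, by simp, ?_⟩
    intro P h2 _ hc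
    have hA' : A = ∅ := by simpa using hA
    rw [mem_singleton]
    by_contra hne
    obtain ⟨p, hp⟩ := Finset.nonempty_iff_ne_empty.mpr hne
    have : p.Nonempty := by rw [← card_pos, h2 p hp]; norm_num
    obtain ⟨x, hx⟩ := this
    have := (hc x).2 ⟨p, hp, hx⟩
    simp [hA'] at this
  | succ n ih =>
    intro A hA
    have hne : A.Nonempty := by rw [← card_pos, hA]; omega
    obtain ⟨a, ha⟩ := hne
    have hcard : ∀ b ∈ A.erase a, ((A.erase a).erase b).card = 2 * n := by
      intro b hb
      rw [card_erase_of_mem hb, card_erase_of_mem ha, hA]; omega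
    have key : ∀ b : R, ∃ F : Finset (Finset (Finset R)), b ∈ A.erase a →
        (F.card ≤ Nat.doubleFactorial (2 * n - 1) ∧
      ∀ P : Finset (Finset R), (∀ p ∈ P, p.card = 2) →
        (∀ p ∈ P, ∀ q ∈ P, p ≠ q → Disjoint p q) →
        (∀ x, x ∈ (A.erase a).erase b ↔ ∃ p ∈ P, x ∈ p) → P ∈ F) := by
      intro b
      by_cases hb : b ∈ A.erase a
      · obtain ⟨F, hF⟩ := ih _ (hcard b hb)
        exact ⟨F, fun _ => hF⟩
      · exact ⟨∅, fun h => absurd h hb⟩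
    choose F hF using key
    refine ⟨(A.erase a).biUnion fun b => (F b).image fun P => insert {a, b} P, ?_, ?_⟩
    · calc _ ≤ (A.erase a).card * Nat.doubleFactorial (2 * n - 1) := by
            apply card_biUnion_le_card_mul
            intro b hb
            exact card_image_le.trans (hF b hb).1
        _ = (2 * n + 1) * Nat.doubleFactorial (2 * n - 1) := by
            rw [card_erase_of_mem ha, hA]; rfl
        _ = Nat.doubleFactorial (2 * (n + 1) - 1) := by
            rcases n with _ | k
            · rfl
            · have : 2 * (k + 1 + 1) - 1 = (2 * k + 1) + 2 := by omega
              rw [this, Nat.doubleFactorial_add_two]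
              rfl
        _ ≤ _ := le_rfl
    · intro P h2 hd hc
      obtain ⟨p, hp, hap⟩ := (hc a).1 ha
      obtain ⟨b, hb⟩ : ∃ b, a ≠ b ∧ p = {a, b} := by
        obtain ⟨x, y, hxy, rfl⟩ := card_eq_two.1 (h2 p hp)
        simp only [mem_insert, mem_singleton] at hap
        rcases hap with rfl | rfl
        · exact ⟨y, hxy, rfl⟩
        · exact ⟨x, hxy.symm, pair_comm _ _⟩
      obtain ⟨hab, rfl⟩ := hb
      have hbA : b ∈ A.erase a := by
        rw [mem_erase]
        exact ⟨hab.symm, (hc b).2 ⟨_, hp, by simp⟩⟩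
      rw [mem_biUnion]
      refine ⟨b, hbA, ?_⟩
      rw [mem_image]
      refine ⟨P.erase {a, b}, ?_, insert_erase hp⟩
      apply (hF b hbA).2
      · intro q hq; exact h2 q (mem_of_mem_erase hq)
      · intro q hq r hr; exact hd q (mem_of_mem_erase hq) r (mem_of_mem_erase hr)
      · intro x
        constructor
        · intro hx
          simp only [mem_erase] at hx
          obtain ⟨q, hq, hxq⟩ := (hc x).1 hx.2.2
          refine ⟨q, mem_erase.2 ⟨?_, hq⟩, hxq⟩
          rintro rfl
          simp only [mem_insert, mem_singleton] at hxq
          tauto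
        · rintro ⟨q, hq, hxq⟩
          rw [mem_erase] at hq
          have hdis := hd q hq.2 _ hp hq.1
          have hx' := disjoint_left.1 hdis hxq
          simp only [mem_insert, mem_singleton, not_or] at hx'
          simp only [mem_erase]
          exact ⟨hx'.2, hx'.1, (hc x).2 ⟨q, hq.2, hxq⟩⟩

/-- Exponential-moment count. -/
lemma seg_count {R : Type*} [Fintype R] [DecidableEq R] (n s : ℕ)
    (B : Fin n → Finset R) (h2 : ∀ j, (B j).card = 2) (hc : ∀ r : R, ∃ j, r ∈ B j)
    (A : Finset (Finset R))
    (hA : ∀ S ∈ A, (univ.filter (fun j => (S ∩ B j).card = 1)).card ≤ s) :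
    (A.card : ℝ) ≤ 3 ^ s * (8 / 3) ^ n := by
  set w : Finset R → ℝ := fun T => if T.card = 1 then 1 / 3 else 1 with hw
  have hw0 : ∀ T, 0 ≤ w T := by intro T; simp only [hw]; split_ifs <;> norm_num
  have hsum : ∀ j, ∑ T ∈ (B j).powerset, w T = 8 / 3 := by
    intro j
    obtain ⟨x, y, hxy, hB⟩ := card_eq_two.1 (h2 j)
    rw [hB, sum_powerset_insert (by simpa using hxy)]
    have : ({y} : Finset R).powerset = {∅, {y}} := by
      ext T; simp [subset_singleton_iff]
    rw [this, sum_pair (by simp [eq_comm]), sum_pair (by simp [eq_comm])]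
    simp [hw, card_pair hxy]
    norm_num
  have hprod : ∀ S : Finset R, ∏ j, w (S ∩ B j)
      = (1 / 3 : ℝ) ^ (univ.filter (fun j => (S ∩ B j).card = 1)).card := by
    intro S
    simp only [hw]
    rw [prod_ite]
    simp
  have hinj : Set.InjOn (fun (S : Finset R) (j : Fin n) => S ∩ B j) (A : Set (Finset R)) := by
    intro S _ T _ h
    ext r
    obtain ⟨j, hj⟩ := hc r
    have := congrFun h j
    have := Finset.ext_iff.1 this r
    simpa [hj] using this
  have hle : (A.card : ℝ) * (1 / 3) ^ s ≤ (8 / 3) ^ n := by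
    calc (A.card : ℝ) * (1 / 3) ^ s = ∑ S ∈ A, (1 / 3 : ℝ) ^ s := by simp
      _ ≤ ∑ S ∈ A, ∏ j, w (S ∩ B j) := by
          apply sum_le_sum
          intro S hS
          rw [hprod]
          exact pow_le_pow_of_le_one (by norm_num) (by norm_num) (hA S hS)
      _ = ∑ f ∈ A.image (fun (S : Finset R) (j : Fin n) => S ∩ B j), ∏ j, w (f j) := by
          rw [sum_image hinj]
      _ ≤ ∑ f ∈ Fintype.piFinset (fun j => (B j).powerset), ∏ j, w (f j) := by
          apply sum_le_sum_of_subset_of_nonneg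
          · intro f hf
            obtain ⟨S, _, rfl⟩ := mem_image.1 hf
            simp [Fintype.mem_piFinset, inter_subset_right]
          · intro f _ _
            exact prod_nonneg fun j _ => hw0 _
      _ = ∏ j, ∑ T ∈ (B j).powerset, w T := (prod_univ_sum _ _).symm
      _ = (8 / 3) ^ n := by simp only [hsum]; rw [prod_const, card_univ, Fintype.card_fin]
  have h3 : (3 : ℝ) ^ s * (1 / 3) ^ s = 1 := by rw [← mul_pow]; norm_num
  calc (A.card : ℝ) = 3 ^ s * (A.card * (1 / 3) ^ s) := by
        rw [mul_left_comm, h3, mul_one]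
    _ ≤ _ := by gcongr

lemma seg_four (s : ℕ) (hs : 4 ≤ s) : 4 * s ≤ 2 ^ s := by
  induction s, hs using Nat.le_induction with
  | base => norm_num
  | succ s hs ih => rw [pow_succ]; omega

/-- Single-set probability bound. -/
lemma seg_single {R : Type*} [Fintype R] [DecidableEq R] (s : ℕ)
    (hR : Fintype.card R = 2 * (4 * s))
    (B : Fin (4 * s) → Finset R) (h2 : ∀ j, (B j).card = 2) (hc : ∀ r : R, ∃ j, r ∈ B j)
    (A : Finset (Finset R)) (hAc : ∀ S ∈ A, S.card = 4 * s)
    (hA : ∀ S ∈ A, (univ.filter (fun j => (S ∩ B j).card = 1)).card ≤ s) :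
    (A.card : ℝ) ≤ 2 * Real.exp (-(s : ℝ) / 8) * (Nat.choose (2 * (4 * s)) (4 * s) : ℝ) := by
  have hN0 : (0 : ℝ) ≤ (Nat.choose (2 * (4 * s)) (4 * s) : ℝ) := Nat.cast_nonneg _
  rcases Nat.lt_or_ge s 4 with h4 | h4
  · have hle : A.card ≤ Nat.choose (2 * (4 * s)) (4 * s) := by
      rw [← hR, ← card_univ, ← card_powersetCard]
      apply card_le_card
      intro S hS
      rw [mem_powersetCard]
      exact ⟨subset_univ _, hAc S hS⟩
    have hs3 : (s : ℝ) ≤ 3 := by exact_mod_cast Nat.lt_succ_iff.1 h4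
    have he : (1 : ℝ) ≤ 2 * Real.exp (-(s : ℝ) / 8) := by
      have := Real.add_one_le_exp (-(s : ℝ) / 8)
      linarith
    calc (A.card : ℝ) ≤ 1 * (Nat.choose (2 * (4 * s)) (4 * s) : ℝ) := by
          rw [one_mul]; exact_mod_cast hle
      _ ≤ _ := by gcongr
  · have h1 := seg_count (4 * s) s B h2 hc A hA
    have hcb := seg_central (4 * s) (by omega)
    rw [Nat.centralBinom] at hcb
    set N := Nat.choose (2 * (4 * s)) (4 * s)
    have hcb' : (16 : ℝ) ^ (4 * s) ≤ 4 * (4 * s) * (N : ℝ) ^ 2 := by exact_mod_cast hcb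
    have h4s : (4 * s : ℝ) ≤ 2 ^ s := by exact_mod_cast seg_four s h4
    have he : (512 / 729 : ℝ) ≤ Real.exp (-(1 / 4)) := by
      have := Real.add_one_le_exp (-(1 / 4) : ℝ)
      linarith
    refine (sq_le_sq₀ (by positivity) (by positivity)).1 ?_
    calc (A.card : ℝ) ^ 2 ≤ (3 ^ s * (8 / 3) ^ (4 * s)) ^ 2 := by gcongr
      _ = 16 ^ (4 * s) * (256 / 729) ^ s := by
          rw [pow_mul, pow_mul, ← mul_pow, ← pow_mul, mul_comm s 2, pow_mul, ← mul_pow]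
          norm_num
      _ ≤ (4 * (4 * s) * (N : ℝ) ^ 2) * (256 / 729) ^ s := by gcongr
      _ ≤ (4 * 2 ^ s * (N : ℝ) ^ 2) * (256 / 729) ^ s := by gcongr
      _ = 4 * (N : ℝ) ^ 2 * (512 / 729) ^ s := by
          have : (512 / 729 : ℝ) ^ s = 2 ^ s * (256 / 729) ^ s := by
            rw [← mul_pow]; norm_num
          rw [this]; ring
      _ ≤ 4 * (N : ℝ) ^ 2 * Real.exp (-(1 / 4)) ^ s := by gcongr
      _ = (2 * Real.exp (-(s : ℝ) / 8) * N) ^ 2 := by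
          rw [mul_pow, mul_pow, ← Real.exp_nat_mul, ← Real.exp_nat_mul]
          have : (s : ℝ) * (-(1 / 4)) = ((2 : ℕ) : ℝ) * (-(s : ℝ) / 8) := by push_cast; ring
          rw [this]; ring

/-- The union-bound estimate for `p_m` in the proof of Lemma 4 of the paper: with
`(S i)_{i ∈ L}` chosen as a uniformly random function from `L` to the `(m/4)`-element
subsets of `R` (i.e., independently uniform `(m/4)`-subsets), the probability `p_m` that
some set `M ⊆ L` of size `m/4` has a segmentation — i.e., that there exist `M` and a
partition of `R` into two-element blocks `B 1, …, B (m/4)` such that for every `i ∈ M`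
at most `m/16` blocks meet `S i` in exactly one element — is at most
`C(m/2, m/4) · (m/2 − 1)!! · 2^{m/4} · exp(−m²/512)`. The probability is expressed as
the number of such functions divided by the total number `C(m/2, m/4)^{m/2}`. -/
theorem segmentation_probability_union_bound
    {L R : Type*} [Fintype L] [Fintype R] [DecidableEq L] [DecidableEq R]
    (m : ℕ) (hm : 0 < m) (h32 : 32 ∣ m)
    (hL : Fintype.card L = m / 2) (hR : Fintype.card R = m / 2) :
    (Nat.card {S : L → Finset R //
        (∀ i, (S i).card = m / 4) ∧
        ∃ M : Finset L, M.card = m / 4 ∧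
          ∃ B : Fin (m / 4) → Finset R,
            (∀ j, (B j).card = 2) ∧
            (∀ j k, j ≠ k → Disjoint (B j) (B k)) ∧
            (∀ r : R, ∃ j, r ∈ B j) ∧
            ∀ i ∈ M,
              (Finset.univ.filter (fun j => (S i ∩ B j).card = 1)).card ≤ m / 16} : ℝ)
      / (Nat.choose (m / 2) (m / 4) : ℝ) ^ (m / 2)
    ≤ (Nat.choose (m / 2) (m / 4) : ℝ) * (Nat.doubleFactorial (m / 2 - 1) : ℝ)
        * 2 ^ (m / 4) * Real.exp (-(m : ℝ) ^ 2 / 512) := by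
  classical
  obtain ⟨t, rfl⟩ := h32
  obtain ⟨s, hs⟩ : ∃ s, s = 2 * t := ⟨_, rfl⟩
  have e2 : 32 * t / 2 = 2 * (4 * s) := by omega
  have e4 : 32 * t / 4 = 4 * s := by omega
  have e16 : 32 * t / 16 = s := by omega
  have em : ((32 * t : ℕ) : ℝ) = 16 * s := by rw [hs]; push_cast; ring
  rw [em]
  rw [e2] at hL hR
  generalize 32 * t / 4 = a at e4 ⊢
  subst e4
  rw [e2, e16]
  set N := Nat.choose (2 * (4 * s)) (4 * s) with hN
  have hNpos : 0 < N := Nat.choose_pos (by omega)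
  have hNR : (0 : ℝ) < N := by exact_mod_cast hNpos
  obtain ⟨F, hFc, hF⟩ := seg_matchings (4 * s) (univ : Finset R) (by rw [card_univ, hR])
  set good : Finset (Finset R) → (Fin (4 * s) → Finset R) → Prop := fun P B =>
    (∀ j, (B j).card = 2) ∧ (∀ j k, j ≠ k → Disjoint (B j) (B k)) ∧
    (∀ r : R, ∃ j, r ∈ B j) ∧ univ.image B = P with hgood
  set G := F.filter (fun P => ∃ B, good P B) with hG
  have hinj : ∀ P B, good P B → Function.Injective B := by
    rintro P B ⟨h2, hd, -, -⟩ j k hjk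
    by_contra hne
    have h := hd j k hne
    rw [hjk, disjoint_self_iff_empty] at h
    have := h2 k
    rw [h] at this
    simp at this
  have hfilt : ∀ P B, good P B → ∀ S : Finset R,
      (P.filter (fun p => (S ∩ p).card = 1)).card
        = (univ.filter (fun j => (S ∩ B j).card = 1)).card := by
    intro P B h S
    have hi := hinj P B h
    obtain ⟨-, -, -, rfl⟩ := h
    rw [filter_image, card_image_of_injective _ hi]
  set A : Finset (Finset R) → Finset (Finset R) := fun P =>
    (powersetCard (4 * s) univ).filter
      (fun S => (P.filter (fun p => (S ∩ p).card = 1)).card ≤ s) with hA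
  set bad : Finset L → Finset (Finset R) → Finset (L → Finset R) := fun M P =>
    Fintype.piFinset (fun i => if i ∈ M then A P else powersetCard (4 * s) univ) with hbad
  have hPC : (powersetCard (4 * s) (univ : Finset R)).card = N := by
    rw [card_powersetCard, card_univ, hR]
  set q : ℝ := 2 * Real.exp (-(s : ℝ) / 8) with hq
  have hq0 : 0 ≤ q := by positivity
  have hAcard : ∀ P ∈ G, ((A P).card : ℝ) ≤ q * N := by
    intro P hP
    obtain ⟨-, B, hB⟩ := mem_filter.1 hP
    apply seg_single s hR B hB.1 hB.2.2.1
    · intro S hS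
      exact (mem_powersetCard.1 (mem_filter.1 hS).1).2
    · intro S hS
      rw [← hfilt P B hB]
      exact (mem_filter.1 hS).2
  have hbadcard : ∀ M ∈ powersetCard (4 * s) (univ : Finset L), ∀ P ∈ G,
      ((bad M P).card : ℝ) ≤ q ^ (4 * s) * (N : ℝ) ^ (2 * (4 * s)) := by
    intro M hM P hP
    have hMc := (mem_powersetCard.1 hM).2
    have : (bad M P).card = (A P).card ^ (4 * s) * N ^ (4 * s) := by
      simp only [hbad]
      rw [Fintype.card_piFinset]
      simp only [apply_ite Finset.card]
      rw [prod_ite, prod_const, prod_const, hPC]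
      have h1 : (univ.filter (fun i => i ∈ M)) = M := by ext; simp
      have h2 : (univ.filter (fun i => i ∉ M)) = Mᶜ := by ext; simp
      rw [h1, h2, card_compl, hMc, hL]
      congr 2
      omega
    rw [this]
    push_cast
    calc ((A P).card : ℝ) ^ (4 * s) * (N : ℝ) ^ (4 * s)
        ≤ (q * N) ^ (4 * s) * (N : ℝ) ^ (4 * s) := by
          gcongr
          exact hAcard P hP
      _ = _ := by rw [mul_pow, two_mul (4 * s), pow_add]; ring
  set U := (powersetCard (4 * s) (univ : Finset L)).biUnion (fun M => G.biUnion (bad M)) with hU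
  have hUcard : (U.card : ℝ) ≤ N * (Nat.doubleFactorial (2 * (4 * s) - 1) : ℝ)
      * (q ^ (4 * s) * (N : ℝ) ^ (2 * (4 * s))) := by
    have hLc : (powersetCard (4 * s) (univ : Finset L)).card = N := by
      rw [card_powersetCard, card_univ, hL]
    have hGc : (G.card : ℝ) ≤ (Nat.doubleFactorial (2 * (4 * s) - 1) : ℝ) := by
      exact_mod_cast (card_filter_le _ _).trans hFc
    calc (U.card : ℝ) ≤ ∑ M ∈ powersetCard (4 * s) (univ : Finset L), ∑ P ∈ G,
          ((bad M P).card : ℝ) := by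
          have : U.card ≤ ∑ M ∈ powersetCard (4 * s) (univ : Finset L), ∑ P ∈ G,
              (bad M P).card :=
            card_biUnion_le.trans (sum_le_sum fun M _ => card_biUnion_le)
          exact_mod_cast this
      _ ≤ ∑ M ∈ powersetCard (4 * s) (univ : Finset L), ∑ P ∈ G,
          (q ^ (4 * s) * (N : ℝ) ^ (2 * (4 * s))) :=
          sum_le_sum fun M hM => sum_le_sum fun P hP => hbadcard M hM P hP
      _ = N * (G.card : ℝ) * (q ^ (4 * s) * (N : ℝ) ^ (2 * (4 * s))) := by
          rw [sum_const, sum_const, hLc, nsmul_eq_mul, nsmul_eq_mul, mul_assoc]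
      _ ≤ _ := by gcongr
  rw [Nat.card_eq_fintype_card, Fintype.card_subtype]
  rw [div_le_iff₀ (by positivity)]
  refine le_trans ?_ (hUcard.trans (le_of_eq ?_))
  · rw [Nat.cast_le]
    apply card_le_card
    intro S hS
    obtain ⟨hSc, M, hM, B, h2, hd, hc, hseg⟩ := (mem_filter.1 hS).2
    have hgd : good (univ.image B) B := ⟨h2, hd, hc, rfl⟩
    simp only [hU, mem_biUnion]
    refine ⟨M, mem_powersetCard.2 ⟨subset_univ _, hM⟩, univ.image B, ?_, ?_⟩
    · rw [hG, mem_filter]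
      refine ⟨hF _ ?_ ?_ ?_, B, hgd⟩
      · intro p hp
        obtain ⟨j, -, rfl⟩ := mem_image.1 hp
        exact h2 j
      · intro p hp r hr hne
        obtain ⟨j, -, rfl⟩ := mem_image.1 hp
        obtain ⟨k, -, rfl⟩ := mem_image.1 hr
        exact hd j k (fun h => hne (by rw [h]))
      · intro x
        obtain ⟨j, hj⟩ := hc x
        simp only [mem_univ, true_iff]
        exact ⟨B j, mem_image_of_mem _ (mem_univ _), hj⟩
    · simp only [hbad, Fintype.mem_piFinset]
      intro i
      have hi : S i ∈ powersetCard (4 * s) (univ : Finset R) :=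
        mem_powersetCard.2 ⟨subset_univ _, hSc i⟩
      split_ifs with hiM
      · rw [hA, mem_filter]
        refine ⟨hi, ?_⟩
        rw [hfilt _ B hgd]
        exact hseg i hiM
      · exact hi
  · have : q ^ (4 * s) = 2 ^ (4 * s) * Real.exp (-(16 * (s : ℝ)) ^ 2 / 512) := by
      rw [hq, mul_pow, ← Real.exp_nat_mul]
      congr 2
      push_cast
      ring
    rw [this]
    ring
end

section
/- For each positive integer m divisible by 32, let L and R be finite sets with |L| = |R| = m/2, let (S_i)_{i∈L} be independent random variables each distributed uniformly on the (m/4)-element subsets of R (equivalently, a uniformly random function S : L → {(m/4)-subsets of R}), and let p_m be the probability that there exist a set M ⊆ L with |M| = m/4 and a partition of R into two-element blocks R_1, …, R_{m/4} such that for every i ∈ M at most m/16 of the blocks satisfy |S_i ∩ R_j| = 1. Then p_m → 0 as m → ∞ over positive multiples of 32; that is, the sequence t ↦ p_{32t} tends to 0 as t → ∞. -/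
open Finset Filter

/-- For a positive multiple `m` of 32, `segmentationProbability m` is the probability
`p_m` that, when `(S i)` is a uniformly random function from a set `L` of `m/2` agents
to the `(m/4)`-element subsets of a set `R` of `m/2` agents (i.e., the `S i` are
independent uniform `(m/4)`-subsets of `R`), there exist a set `M ⊆ L` with
`|M| = m/4` and a partition of `R` into two-element blocks `B 1, …, B (m/4)` such that
for every `i ∈ M` at most `m/16` of the blocks meet `S i` in exactly one element (i.e.,
some `M` of size `m/4` has a segmentation). It is expressed as the number of such
functions divided by the total number `C(m/2, m/4)^{m/2}` of functions, with
`L = R = Fin (m/2)`. -/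
noncomputable def segmentationProbability (m : ℕ) : ℝ :=
  (Nat.card {S : Fin (m / 2) → Finset (Fin (m / 2)) //
      (∀ i, (S i).card = m / 4) ∧
      ∃ M : Finset (Fin (m / 2)), M.card = m / 4 ∧
        ∃ B : Fin (m / 4) → Finset (Fin (m / 2)),
          (∀ j, (B j).card = 2) ∧
          (∀ j k, j ≠ k → Disjoint (B j) (B k)) ∧
          (∀ r, ∃ j, r ∈ B j) ∧
          ∀ i ∈ M,
            (Finset.univ.filter (fun j => (S i ∩ B j).card = 1)).card ≤ m / 16} : ℝ)
    / (Nat.choose (m / 2) (m / 4) : ℝ) ^ (m / 2)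

/-- Sets of at most `2t` blocks out of `8t`. -/
lemma seg_small_sets (t : ℕ) :
    ((univ : Finset (Finset (Fin (8 * t)))).filter (fun J => J.card ≤ 2 * t)).card
      ≤ 2 ^ (7 * t) := by
  have h1 : ∑ J : Finset (Fin (8 * t)), 2 ^ (8 * t - J.card) = 3 ^ (8 * t) := by
    have := Finset.sum_pow_mul_eq_add_pow (1 : ℕ) 2 (univ : Finset (Fin (8 * t)))
    simpa using this
  have h2 : ((univ : Finset (Finset (Fin (8 * t)))).filter (fun J => J.card ≤ 2 * t)).card
      * 2 ^ (6 * t) ≤ 3 ^ (8 * t) := by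
    rw [← h1, ← smul_eq_mul, ← Finset.sum_const]
    calc _ ≤ ∑ J ∈ (univ : Finset (Finset (Fin (8 * t)))).filter (fun J => J.card ≤ 2 * t),
              2 ^ (8 * t - J.card) := by
            apply Finset.sum_le_sum
            intro J hJ
            have := (Finset.mem_filter.mp hJ).2
            exact Nat.pow_le_pow_right (by norm_num) (by omega)
      _ ≤ _ := Finset.sum_le_sum_of_subset (Finset.filter_subset _ _)
  have h3 : (3 : ℕ) ^ (8 * t) ≤ 2 ^ (7 * t) * 2 ^ (6 * t) := by
    rw [← pow_add, show 7 * t + 6 * t = 13 * t by ring, pow_mul, pow_mul]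
    exact Nat.pow_le_pow_left (by norm_num) t
  exact Nat.le_of_mul_le_mul_right (h2.trans h3) (by positivity)

/-- Sets splitting at most `2t` blocks of a fixed partition. -/
lemma seg_bad_sets (t : ℕ) {n : ℕ} (B : Fin (8 * t) → Finset (Fin n))
    (hB : ∀ j, (B j).card = 2) (hc : ∀ r, ∃ j, r ∈ B j) :
    ((univ : Finset (Finset (Fin n))).filter (fun S =>
      ((univ : Finset (Fin (8 * t))).filter (fun j => (S ∩ B j).card = 1)).card ≤ 2 * t)).card
      ≤ 2 ^ (15 * t) := by
  have hfg : ∀ j, ∃ f g, f ≠ g ∧ B j = {f, g} := fun j => by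
    obtain ⟨f, g, h⟩ := Finset.card_eq_two.mp (hB j)
    exact ⟨f, g, h⟩
  choose f g hne hfg using hfg
  have key : ∀ (S : Finset (Fin n)) j, (S ∩ B j).card = 1 ↔ ¬ (f j ∈ S ↔ g j ∈ S) := by
    intro S j
    rw [hfg j]
    by_cases h1 : f j ∈ S <;> by_cases h2 : g j ∈ S
    · have : S ∩ {f j, g j} = {f j, g j} := by ext x; simp; grind
      rw [this, Finset.card_pair (hne j)]; simp [h1, h2]
    · have : S ∩ {f j, g j} = {f j} := by ext x; simp; grind
      rw [this]; simp [h1, h2]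
    · have : S ∩ {f j, g j} = {g j} := by ext x; simp; grind
      rw [this]; simp [h1, h2]
    · have : S ∩ {f j, g j} = ∅ := by ext x; simp; grind
      rw [this]; simp [h1, h2]
  calc _ ≤ (((univ : Finset (Finset (Fin (8 * t)))).filter (fun J => J.card ≤ 2 * t)) ×ˢ
            (univ : Finset (Finset (Fin (8 * t))))).card := by
        apply Finset.card_le_card_of_injOn (fun S =>
          ((univ : Finset (Fin (8 * t))).filter (fun j => (S ∩ B j).card = 1),
           (univ : Finset (Fin (8 * t))).filter (fun j => f j ∈ S)))
        · intro S hS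
          simpa using hS
        · intro S _ T _ h
          simp only [Prod.mk.injEq, Finset.ext_iff, mem_filter, mem_univ, true_and, key] at h
          obtain ⟨h1, h2⟩ := h
          ext r
          obtain ⟨j, hj⟩ := hc r
          rw [hfg j] at hj
          have a := h1 j
          have b := h2 j
          simp only [mem_insert, mem_singleton] at hj
          rcases hj with rfl | rfl
          · exact b
          · tauto
    _ ≤ 2 ^ (7 * t) * 2 ^ (8 * t) := by
        rw [Finset.card_product]
        exact Nat.mul_le_mul (seg_small_sets t) (by simp)
    _ = _ := by rw [← pow_add]; congr 1; ring

/-- The union bound. -/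
lemma seg_count_s13 (t : ℕ) :
    Nat.card {S : Fin (16 * t) → Finset (Fin (16 * t)) //
      (∀ i, (S i).card = 8 * t) ∧
      ∃ M : Finset (Fin (16 * t)), M.card = 8 * t ∧
        ∃ B : Fin (8 * t) → Finset (Fin (16 * t)),
          (∀ j, (B j).card = 2) ∧
          (∀ j k, j ≠ k → Disjoint (B j) (B k)) ∧
          (∀ r, ∃ j, r ∈ B j) ∧
          ∀ i ∈ M,
            (Finset.univ.filter (fun j => (S i ∩ B j).card = 1)).card ≤ 2 * t}
    ≤ (2 ^ (16 * t) * ((16 * t) ^ 2) ^ (8 * t)) *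
        ((2 ^ (15 * t)) ^ (8 * t) * (Nat.choose (16 * t) (8 * t)) ^ (8 * t)) := by
  classical
  set I : Finset (Finset (Fin (16 * t)) × (Fin (8 * t) → Finset (Fin (16 * t)))) :=
    ((powersetCard (8 * t) univ) ×ˢ
      (Fintype.piFinset (fun _ : Fin (8 * t) => powersetCard 2 univ))).filter
        (fun p => ∀ r, ∃ j, r ∈ p.2 j) with hI
  set F : (Finset (Fin (16 * t)) × (Fin (8 * t) → Finset (Fin (16 * t)))) →
      Finset (Fin (16 * t) → Finset (Fin (16 * t))) := fun p =>
    Fintype.piFinset (fun i => if i ∈ p.1 then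
      ((univ : Finset (Finset (Fin (16 * t)))).filter (fun S =>
        ((univ : Finset (Fin (8 * t))).filter (fun j => (S ∩ p.2 j).card = 1)).card ≤ 2 * t))
      else powersetCard (8 * t) univ) with hF
  have hIc : I.card ≤ 2 ^ (16 * t) * ((16 * t) ^ 2) ^ (8 * t) := by
    refine (Finset.card_filter_le _ _).trans ?_
    rw [Finset.card_product]
    apply Nat.mul_le_mul
    · exact (Finset.card_le_univ _).trans (by simp)
    · simp only [Fintype.card_piFinset, card_powersetCard, card_univ, Fintype.card_fin,
        prod_const]
      exact Nat.pow_le_pow_left (Nat.choose_le_pow _ _) _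
  have hFc : ∀ p ∈ I, (F p).card ≤
      (2 ^ (15 * t)) ^ (8 * t) * (Nat.choose (16 * t) (8 * t)) ^ (8 * t) := by
    intro p hp
    simp only [hI, mem_filter, mem_product, mem_powersetCard, Fintype.mem_piFinset] at hp
    obtain ⟨⟨⟨_, hM⟩, hB⟩, hc⟩ := hp
    have hbad := seg_bad_sets t p.2 (fun j => (hB j).2) hc
    simp only [hF, Fintype.card_piFinset]
    have hcc : (univ.filter (fun i => i ∉ p.1)).card = 8 * t := by
      have := Finset.card_compl p.1
      rw [hM, Fintype.card_fin] at this
      have h2 : univ.filter (fun i => i ∉ p.1) = p.1ᶜ := by ext; simp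
      rw [h2, this]; omega
    have hcM : (univ.filter (fun i => i ∈ p.1)).card = 8 * t := by
      rw [Finset.filter_univ_mem, hM]
    simp only [apply_ite Finset.card]
    rw [Finset.prod_ite, prod_const, prod_const, hcc, hcM]
    apply Nat.mul_le_mul
    · exact Nat.pow_le_pow_left hbad _
    · simp
  rw [Nat.card_eq_fintype_card, Fintype.card_subtype]
  refine le_trans (Finset.card_le_card (t := I.biUnion F) ?_) ?_
  · intro S hS
    simp only [mem_filter, mem_univ, true_and] at hS
    obtain ⟨hS, M, hM, B, hB, -, hc, h⟩ := hS
    rw [Finset.mem_biUnion]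
    refine ⟨(M, B), ?_, ?_⟩
    · simp [hI, hM, hB, hc]
    · simp only [hF, Fintype.mem_piFinset]
      intro i
      by_cases hi : i ∈ M
      · simpa [hi] using h i hi
      · simp [hi, hS]
  · exact (Finset.card_biUnion_le_card_mul _ _ _ hFc).trans (Nat.mul_le_mul_right _ hIc)

lemma seg_bound (t : ℕ) (ht : 0 < t) :
    segmentationProbability (32 * t) ≤ (4 * (16 * (t : ℝ)) ^ 3 / 2 ^ t) ^ (8 * t) := by
  unfold segmentationProbability
  rw [show 32 * t / 2 = 16 * t by omega, show 32 * t / 4 = 8 * t by omega,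
    show 32 * t / 16 = 2 * t by omega]
  have hcount := seg_count_s13 t
  set N := Nat.card _
  have hC : (0 : ℝ) < (Nat.choose (16 * t) (8 * t) : ℝ) := by
    exact_mod_cast Nat.choose_pos (by omega)
  have hC2 : (2 : ℝ) ^ (16 * t) ≤ 16 * t * (Nat.choose (16 * t) (8 * t) : ℝ) := by
    have := Nat.four_pow_le_two_mul_self_mul_centralBinom (8 * t) (by omega)
    rw [Nat.centralBinom_eq_two_mul_choose, show 2 * (8 * t) = 16 * t by ring,
      show (4 : ℕ) = 2 ^ 2 by norm_num, ← pow_mul, show 2 * (8 * t) = 16 * t by ring] at this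
    exact_mod_cast this
  set C : ℝ := (Nat.choose (16 * t) (8 * t) : ℝ) with hCdef
  have hN : (N : ℝ) ≤ (2 ^ (16 * t) * ((16 * t) ^ 2) ^ (8 * t)) *
        ((2 ^ (15 * t)) ^ (8 * t) * C ^ (8 * t)) := by
    rw [hCdef]; exact_mod_cast hcount
  rw [div_le_iff₀ (by positivity)]
  refine hN.trans ?_
  have e1 : (2 : ℝ) ^ (16 * t) = 4 ^ (8 * t) := by
    rw [show (4 : ℝ) = 2 ^ 2 by norm_num, ← pow_mul]; congr 1; ring
  have l1 : ((2 : ℝ) ^ (16 * t) * ((16 * t) ^ 2) ^ (8 * t)) *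
        ((2 ^ (15 * t)) ^ (8 * t) * C ^ (8 * t)) =
      (4 * (16 * (t : ℝ)) ^ 2 * 2 ^ (15 * t)) ^ (8 * t) * C ^ (8 * t) := by
    rw [e1, mul_pow (4 * (16 * (t : ℝ)) ^ 2), mul_pow 4, mul_assoc, mul_assoc, mul_assoc]
  have l2 : (4 * (16 * (t : ℝ)) ^ 3 / 2 ^ t) ^ (8 * t) * C ^ (16 * t) =
      (4 * (16 * (t : ℝ)) ^ 3 / 2 ^ t * C) ^ (8 * t) * C ^ (8 * t) := by
    rw [mul_pow _ C, mul_assoc, ← pow_add]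
    congr 2; ring
  rw [l1, l2]
  refine mul_le_mul_of_nonneg_right ?_ (by positivity)
  refine pow_le_pow_left₀ (by positivity) ?_ _
  have e2 : (2 : ℝ) ^ (15 * t) * 2 ^ t = 2 ^ (16 * t) := by
    rw [← pow_add]; congr 1; ring
  rw [div_mul_eq_mul_div, le_div_iff₀ (by positivity), mul_assoc, e2]
  calc _ ≤ 4 * (16 * (t : ℝ)) ^ 2 * (16 * t * C) := by gcongr
    _ = _ := by ring

/-- Lemma 4 of the paper: the probability `p_m` that some set `M ⊆ L` of size `m/4` has
a segmentation tends to `0` as `m → ∞` over positive multiples of 32; that is,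
`t ↦ p_{32t}` tends to `0` as `t → ∞`. -/
theorem segmentation_probability_tendsto_zero :
    Tendsto (fun t : ℕ => segmentationProbability (32 * t)) atTop (nhds 0) := by
  have h0 : Tendsto (fun t : ℕ => 4 * (16 * (t : ℝ)) ^ 3 / 2 ^ t) atTop (nhds 0) := by
    have := (tendsto_pow_const_div_const_pow_of_one_lt 3 (r := (2 : ℝ)) (by norm_num)).const_mul
      (4 * 16 ^ 3)
    rw [mul_zero] at this
    refine this.congr (fun t => ?_)
    ring
  refine tendsto_of_tendsto_of_tendsto_of_le_of_le' tendsto_const_nhds h0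
    (Eventually.of_forall fun t => ?_) ?_
  · unfold segmentationProbability; positivity
  · filter_upwards [h0.eventually_le_const (show (0 : ℝ) < 1 by norm_num),
      eventually_gt_atTop 0] with t h1 ht
    refine (seg_bound t ht).trans ?_
    exact pow_le_of_le_one (by positivity) h1 (by omega)
end
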